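/- arXiv:1701.01181 — 3 statements merged into one kernel-verified Lean document; each statement's English description precedes it below -/
import Mathlib

section
/- Let X be a set, M ⊆ P'(X), and let O be a lower-Vietoris-type topology on M. Let τ ≥ ℵ₀ and P' ⊆ P(X) be such that {A⁻_M : A ∈ P'} is a subbase for O. If w(X,P') ≤ τ, then the weight of (M,O) is at most τ. In particular, if w(X,P_O) ≤ τ then w(M,O) ≤ τ. -/
open Set TopologicalSpace Topology Cardinal

universe u

variable {X : Type u}

/-- `A⁺_M = {F ∈ M : F ⊆ A}`. -/
def hyperPlus (M : Set (Set X)) (A : Set X) : Set M :=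
  {F | (F : Set X) ⊆ A}

/-- `A⁻_M = {F ∈ M : F ∩ A ≠ ∅}`. -/
def hyperMinus (M : Set (Set X)) (A : Set X) : Set M :=
  {F | ((F : Set X) ∩ A).Nonempty}

/-- `B_O = {A ⊆ X : A⁺_M ∈ O}`. -/
def BOfam (M : Set (Set X)) (O : TopologicalSpace M) : Set (Set X) :=
  {A | IsOpen[O] (hyperPlus M A)}

/-- `P_O = {A ⊆ X : A⁻_M ∈ O}`. -/
def POfam (M : Set (Set X)) (O : TopologicalSpace M) : Set (Set X) :=
  {A | IsOpen[O] (hyperMinus M A)}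

/-- `T₊O`: the topology on `X` with base `B_O`. -/
def TplusO (M : Set (Set X)) (O : TopologicalSpace M) : TopologicalSpace X :=
  generateFrom (BOfam M O)

/-- `T₋O`: the topology on `X` with subbase `P_O`. -/
def TminusO (M : Set (Set X)) (O : TopologicalSpace M) : TopologicalSpace X :=
  generateFrom (POfam M O)

/-- `T_O`: the topology on `X` with subbase `B_O ∪ P_O`. -/
def TofO (M : Set (Set X)) (O : TopologicalSpace M) : TopologicalSpace X :=
  generateFrom (BOfam M O ∪ POfam M O)

/-- `O_u`: the topology on `M` with base `(B_O)⁺_M`. -/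
def Ou (M : Set (Set X)) (O : TopologicalSpace M) : TopologicalSpace M :=
  generateFrom (hyperPlus M '' BOfam M O)

/-- `O_l`: the topology on `M` with subbase `(P_O)⁻_M`. -/
def Ol (M : Set (Set X)) (O : TopologicalSpace M) : TopologicalSpace M :=
  generateFrom (hyperMinus M '' POfam M O)

/-- `O` is a Vietoris-type topology on `M`. -/
def IsVietorisType (M : Set (Set X)) (O : TopologicalSpace M) : Prop :=
  O = generateFrom (hyperPlus M '' BOfam M O ∪ hyperMinus M '' POfam M O)

/-- `O` is a strong Vietoris-type topology on `M`. -/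
def IsStrongVietorisType (M : Set (Set X)) (O : TopologicalSpace M) : Prop :=
  IsVietorisType M O ∧ TplusO M O = TminusO M O

/-- `O` is a Tychonoff-type topology on `M`: `O ∩ {A⁺_M : A ⊆ X}` is a base for `O`. -/
def IsTychonoffType (M : Set (Set X)) (O : TopologicalSpace M) : Prop :=
  @IsTopologicalBasis M O {S | IsOpen[O] S ∧ ∃ A : Set X, S = hyperPlus M A}

/-- `O` is a lower-Vietoris-type topology on `M`:
`O ∩ {A⁻_M : A ⊆ X}` is a subbase for `O`. -/
def IsLowerVietorisType (M : Set (Set X)) (O : TopologicalSpace M) : Prop :=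
  O = generateFrom {S | IsOpen[O] S ∧ ∃ A : Set X, S = hyperMinus M A}

/-- The weight of a topological space: the minimal cardinality of a (topological) base. -/
noncomputable def weightOf (Y : Type u) (t : TopologicalSpace Y) : Cardinal :=
  sInf {c | ∃ B : Set (Set Y), @IsTopologicalBasis Y t B ∧ Cardinal.mk B = c}

/-- `w(X,P)`: the minimal cardinality of a subfamily `P' ⊆ P` such that every point of
every member of `P` is contained in a member of `P'` inside that member. -/
noncomputable def famWeight (X : Type u) (P : Set (Set X)) : Cardinal :=
  sInf {c | ∃ P' ⊆ P, Cardinal.mk P' = c ∧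
    ∀ U ∈ P, ∀ x ∈ U, ∃ V ∈ P', x ∈ V ∧ V ⊆ U}

lemma weightOf_generateFrom_le {Y : Type u} (s : Set (Set Y)) (τ : Cardinal.{u}) (hτ : ℵ₀ ≤ τ)
    (hs : Cardinal.mk s ≤ τ) : weightOf Y (generateFrom s) ≤ τ := by
  have hb := @isTopologicalBasis_of_subbasis Y (generateFrom s) s rfl
  have hle : weightOf Y (generateFrom s) ≤
      Cardinal.mk ((fun f => ⋂₀ f) '' {f : Set (Set Y) | f.Finite ∧ f ⊆ s} : Set (Set Y)) := by
    unfold weightOf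
    apply csInf_le'
    exact ⟨_, hb, rfl⟩
  refine hle.trans ?_
  have hsub : ((fun f => ⋂₀ f) '' {f : Set (Set Y) | f.Finite ∧ f ⊆ s}) ⊆
      Set.range (fun f : Finset s => ⋂₀ (Subtype.val '' (f : Set s))) := by
    rintro _ ⟨f, ⟨hf, hfs⟩, rfl⟩
    have hfin : (Subtype.val ⁻¹' f : Set s).Finite :=
      hf.preimage Subtype.val_injective.injOn
    refine ⟨hfin.toFinset, ?_⟩
    simp only [Set.Finite.coe_toFinset]
    rw [Subtype.image_preimage_coe, Set.inter_eq_right.2 hfs]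
  refine (Cardinal.mk_le_mk_of_subset hsub).trans (Cardinal.mk_range_le.trans ?_)
  rcases finite_or_infinite s with h | h
  · exact (Cardinal.lt_aleph0_of_finite _).le.trans hτ
  · rw [Cardinal.mk_finset_of_infinite]
    exact hs

lemma weightOf_le_of_famWeight (M : Set (Set X)) (O : TopologicalSpace M)
    (τ : Cardinal.{u}) (hτ : ℵ₀ ≤ τ) (P' : Set (Set X))
    (hO : O = generateFrom (hyperMinus M '' P')) (hw : famWeight X P' ≤ τ) :
    weightOf M O ≤ τ := by
  have hne : {c | ∃ Q ⊆ P', Cardinal.mk Q = c ∧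
      ∀ U ∈ P', ∀ x ∈ U, ∃ V ∈ Q, x ∈ V ∧ V ⊆ U}.Nonempty :=
    ⟨_, P', subset_rfl, rfl, fun U hU x hx => ⟨U, hU, hx, subset_rfl⟩⟩
  obtain ⟨Q, hQP, hQc, hQ⟩ := csInf_mem hne
  have hQτ : Cardinal.mk Q ≤ τ := hQc.le.trans hw
  have hgen : O = generateFrom (hyperMinus M '' Q) := by
    rw [hO]
    apply le_antisymm
    · exact generateFrom_anti (Set.image_mono hQP)
    · apply le_generateFrom
      rintro _ ⟨U, hU, rfl⟩
      have : hyperMinus M U = ⋃₀ (hyperMinus M '' {V | V ∈ Q ∧ V ⊆ U}) := by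
        ext F
        simp only [Set.mem_sUnion, Set.mem_image, Set.mem_setOf_eq]
        constructor
        · rintro ⟨x, hxF, hxU⟩
          obtain ⟨V, hV, hxV, hVU⟩ := hQ U hU x hxU
          exact ⟨_, ⟨V, ⟨hV, hVU⟩, rfl⟩, x, hxF, hxV⟩
        · rintro ⟨_, ⟨V, ⟨hV, hVU⟩, rfl⟩, x, hxF, hxV⟩
          exact ⟨x, hxF, hVU hxV⟩
      rw [this]
      refine @isOpen_sUnion _ (generateFrom (hyperMinus M '' Q)) _ ?_
      rintro _ ⟨V, ⟨hV, _⟩, rfl⟩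
      exact isOpen_generateFrom_of_mem ⟨V, hV, rfl⟩
  rw [hgen]
  exact weightOf_generateFrom_le _ τ hτ (Cardinal.mk_image_le.trans hQτ)

/-- let `O` be a lower-Vietoris-type topology on `M ⊆ P'(X)` and
`τ ≥ ℵ₀`.  If `P' ⊆ P(X)` is such that `{A⁻_M : A ∈ P'}` is a subbase for `O` and
`w(X,P') ≤ τ`, then `w(M,O) ≤ τ`.  In particular, if `w(X,P_O) ≤ τ` then
`w(M,O) ≤ τ`. -/
theorem statement10 (M : Set (Set X)) (hM : ∀ A ∈ M, A.Nonempty)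
    (O : TopologicalSpace M) (hL : IsLowerVietorisType M O)
    (τ : Cardinal) (hτ : ℵ₀ ≤ τ) :
    (∀ P' : Set (Set X), O = generateFrom (hyperMinus M '' P') →
      famWeight X P' ≤ τ → weightOf M O ≤ τ) ∧
    (famWeight X (POfam M O) ≤ τ → weightOf M O ≤ τ) := by
  refine ⟨fun P' hO hw => weightOf_le_of_famWeight M O τ hτ P' hO hw, fun hw => ?_⟩
  refine weightOf_le_of_famWeight M O τ hτ _ ?_ hw
  have h : hyperMinus M '' POfam M O = {S | IsOpen[O] S ∧ ∃ A : Set X, S = hyperMinus M A} := by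
    ext S
    constructor
    · rintro ⟨A, hA, rfl⟩
      exact ⟨hA, A, rfl⟩
    · rintro ⟨hS, A, rfl⟩
      exact ⟨A, hS, rfl⟩
  rw [h]
  exact hL
end

section
/- Let X be a set, M ⊆ P'(X), and let O be a Vietoris-type topology on M. Let τ ≥ ℵ₀ with w(X,P_O) ≤ τ, and suppose there exists a family B ⊆ B_O such that |B| ≤ τ and for every M' ∈ M and every U ∈ B_O with M' ⊆ U there exists V ∈ B with M' ⊆ V ⊆ U. Then the weight of (M,O) is at most τ. -/
open Set TopologicalSpace Topology Cardinal

universe u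

variable {X : Type u}

/-- if `O` is a Vietoris-type topology on `M ⊆ P'(X)`, `τ ≥ ℵ₀`,
`w(X,P_O) ≤ τ`, and there is `B ⊆ B_O` with `|B| ≤ τ` such that every `M' ∈ M` and
`U ∈ B_O` with `M' ⊆ U` admit `V ∈ B` with `M' ⊆ V ⊆ U`, then `w(M,O) ≤ τ`. -/
theorem statement11 (M : Set (Set X)) (hM : ∀ A ∈ M, A.Nonempty)
    (O : TopologicalSpace M) (hV : IsVietorisType M O)
    (τ : Cardinal) (hτ : ℵ₀ ≤ τ)
    (hw : famWeight X (POfam M O) ≤ τ)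
    (B : Set (Set X)) (hB : B ⊆ BOfam M O) (hcard : Cardinal.mk B ≤ τ)
    (happrox : ∀ M' ∈ M, ∀ U ∈ BOfam M O, M' ⊆ U → ∃ V ∈ B, M' ⊆ V ∧ V ⊆ U) :
    weightOf M O ≤ τ := by
  classical
  have hne : {c | ∃ P' ⊆ POfam M O, Cardinal.mk P' = c ∧
      ∀ U ∈ POfam M O, ∀ x ∈ U, ∃ V ∈ P', x ∈ V ∧ V ⊆ U}.Nonempty :=
    ⟨_, POfam M O, subset_rfl, rfl, fun U hU x hx => ⟨U, hU, hx, subset_rfl⟩⟩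
  obtain ⟨P, hP, hPc, hPa⟩ := csInf_mem hne
  have hPτ : Cardinal.mk P ≤ τ := hPc.le.trans hw
  let S : Set (Set M) := hyperPlus M '' B ∪ hyperMinus M '' P
  have hSτ : Cardinal.mk S ≤ τ := by
    refine (Cardinal.mk_union_le _ _).trans ?_
    exact Cardinal.add_le_of_le hτ (Cardinal.mk_image_le.trans hcard)
      (Cardinal.mk_image_le.trans hPτ)
  have hgen : O = generateFrom S := by
    apply le_antisymm
    · refine le_generateFrom ?_
      rintro s (⟨A, hA, rfl⟩ | ⟨A, hA, rfl⟩)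
      · exact hB hA
      · exact hP hA
    · letI : TopologicalSpace M := generateFrom S
      have key : generateFrom S ≤
          generateFrom (hyperPlus M '' BOfam M O ∪ hyperMinus M '' POfam M O) := by
        refine le_generateFrom ?_
        rintro s (⟨A, hA, rfl⟩ | ⟨A, hA, rfl⟩)
        · refine (isOpen_iff_forall_mem_open (X := M)).2 ?_
          intro F hF
          obtain ⟨V, hVB, h1, h2⟩ := happrox F.1 F.2 A hA hF
          exact ⟨hyperPlus M V, fun G hG => Set.Subset.trans hG h2,
            isOpen_generateFrom_of_mem (Or.inl ⟨V, hVB, rfl⟩), h1⟩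
        · refine (isOpen_iff_forall_mem_open (X := M)).2 ?_
          rintro F ⟨x, hxF, hxA⟩
          obtain ⟨V, hVP, h1, h2⟩ := hPa A hA x hxA
          exact ⟨hyperMinus M V, fun G hG => hG.mono (inter_subset_inter_right _ h2),
            isOpen_generateFrom_of_mem (Or.inr ⟨V, hVP, rfl⟩), ⟨x, hxF, h1⟩⟩
      exact key.trans hV.ge
  have hbas := @isTopologicalBasis_of_subbasis _ O S hgen
  have hle : weightOf M O ≤ Cardinal.mk ((fun f => ⋂₀ f) '' {f : Set (Set M) | f.Finite ∧ f ⊆ S}) :=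
    csInf_le' ⟨_, hbas, rfl⟩
  refine hle.trans ?_
  have hsub : ((fun f => ⋂₀ f) '' {f : Set (Set M) | f.Finite ∧ f ⊆ S}) ⊆
      Set.range (fun l : List S => ⋂₀ {s : Set M | ∃ h : s ∈ S, (⟨s, h⟩ : S) ∈ l}) := by
    rintro _ ⟨f, ⟨hf, hfS⟩, rfl⟩
    have hfin : ((Subtype.val : S → Set M) ⁻¹' f).Finite :=
      hf.preimage Subtype.val_injective.injOn
    refine ⟨hfin.toFinset.toList, ?_⟩
    change ⋂₀ _ = ⋂₀ f
    congr 1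
    ext s
    simp only [Finset.mem_toList, Set.Finite.mem_toFinset, Set.mem_preimage, Set.mem_setOf_eq]
    exact ⟨fun ⟨_, h⟩ => h, fun h => ⟨hfS h, h⟩⟩
  exact (Cardinal.mk_le_mk_of_subset hsub).trans (Cardinal.mk_range_le.trans
    ((Cardinal.mk_list_le_max _).trans (max_le hτ hSτ)))
end

section
/- Let (X,T) be a T1-space with w(X) ≥ ℵ₀, and let Z(X) denote the set Comp(X) of all nonempty compact (closed) subsets of X endowed with the subspace topology induced by the Vietoris topology V_X on CL(X). Then w(Z(X)) = w(X). -/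
open Set TopologicalSpace Topology Cardinal

universe u

variable {X : Type u}

/-- `CL(X)`: the nonempty closed subsets of `X`. -/
def CLset (X : Type u) [TopologicalSpace X] : Set (Set X) :=
  {F | IsClosed F ∧ F.Nonempty}

/-- The Vietoris topology `V_X` on `CL(X)` (supremum of the upper and lower Vietoris
topologies, i.e. the topology with subbase `{U⁺ : U open} ∪ {U⁻ : U open}`). -/
def vietoris (X : Type u) [TopologicalSpace X] : TopologicalSpace (CLset X) :=
  generateFrom (hyperPlus (CLset X) '' {U : Set X | IsOpen U} ∪
    hyperMinus (CLset X) '' {U : Set X | IsOpen U})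

/-- `Comp(X)`: the compact members of `CL(X)`. -/
def CompSet (X : Type u) [TopologicalSpace X] : Set (CLset X) :=
  {F | IsCompact (F : Set X)}

theorem weight_attained (Y : Type u) (t : TopologicalSpace Y) :
    ∃ B : Set (Set Y), @IsTopologicalBasis Y t B ∧ Cardinal.mk B = weightOf Y t :=
  csInf_mem (s := {c | ∃ B : Set (Set Y), @IsTopologicalBasis Y t B ∧ Cardinal.mk B = c})
    ⟨_, _, isTopologicalBasis_opens, rfl⟩

theorem weight_le_of_basis {Y : Type u} {t : TopologicalSpace Y} {B : Set (Set Y)}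
    (hB : @IsTopologicalBasis Y t B) : weightOf Y t ≤ Cardinal.mk B :=
  csInf_le' ⟨B, hB, rfl⟩

theorem mk_finset_le_aux {α : Type u} {κ : Cardinal.{u}} (hκ : ℵ₀ ≤ κ)
    (h : Cardinal.mk α ≤ κ) : Cardinal.mk (Finset α) ≤ κ := by
  cases finite_or_infinite α
  · exact (Cardinal.lt_aleph0_of_finite (Finset α)).le.trans hκ
  · rwa [Cardinal.mk_finset_of_infinite]

theorem weight_le_of_subbasis {Y : Type u} {t : TopologicalSpace Y} {s : Set (Set Y)}
    (hs : t = generateFrom s) {κ : Cardinal.{u}} (hκ : ℵ₀ ≤ κ) (h : Cardinal.mk s ≤ κ) :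
    weightOf Y t ≤ κ := by
  have hb := isTopologicalBasis_of_subbasis hs
  refine (weight_le_of_basis hb).trans ?_
  have hsub : ((fun f => ⋂₀ f) '' {f : Set (Set Y) | f.Finite ∧ f ⊆ s}) ⊆
      range (fun f : Finset s => ⋂₀ (Subtype.val '' (f : Set s))) := by
    rintro _ ⟨f, ⟨hf, hfs⟩, rfl⟩
    have hfin : (Subtype.val ⁻¹' f : Set s).Finite := hf.preimage Subtype.val_injective.injOn
    refine ⟨hfin.toFinset, ?_⟩
    simp only [Set.Finite.coe_toFinset]
    rw [Subtype.image_preimage_coe, inter_eq_self_of_subset_right hfs]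
  exact (Cardinal.mk_le_mk_of_subset hsub).trans
    (Cardinal.mk_range_le.trans (mk_finset_le_aux hκ h))

theorem statement12 [T : TopologicalSpace X] [T1Space X]
    (hw : ℵ₀ ≤ weightOf X T) :
    weightOf (CompSet X) (TopologicalSpace.induced Subtype.val (vietoris X)) =
      weightOf X T := by
  apply le_antisymm
  · obtain ⟨B, hB, hBc⟩ := weight_attained X T
    let P : Set X → Set (CompSet X) := fun U => Subtype.val ⁻¹' hyperPlus (CLset X) U
    let M : Set X → Set (CompSet X) := fun U => Subtype.val ⁻¹' hyperMinus (CLset X) U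
    let S : Set (Set (CompSet X)) :=
      range (fun f : Finset B => P (⋃ b ∈ f, (b : Set X))) ∪ range (fun b : B => M b)
    have hSle : Cardinal.mk S ≤ weightOf X T := by
      refine (Cardinal.mk_union_le _ _).trans (Cardinal.add_le_of_le hw ?_ ?_)
      · exact Cardinal.mk_range_le.trans (mk_finset_le_aux hw hBc.le)
      · exact Cardinal.mk_range_le.trans hBc.le
    refine weight_le_of_subbasis (s := S) ?_ hw hSle
    rw [vietoris, induced_generateFrom_eq]
    apply le_antisymm
    · apply le_generateFrom
      rintro _ (⟨f, rfl⟩ | ⟨b, rfl⟩)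
      · apply isOpen_generateFrom_of_mem
        exact ⟨_, Or.inl ⟨_, isOpen_biUnion fun b _ => hB.isOpen b.2, rfl⟩, rfl⟩
      · apply isOpen_generateFrom_of_mem
        exact ⟨_, Or.inr ⟨_, hB.isOpen b.2, rfl⟩, rfl⟩
    · apply le_generateFrom
      letI := generateFrom S
      rintro _ ⟨_, (⟨U, hU, rfl⟩ | ⟨U, hU, rfl⟩), rfl⟩
      · rw [isOpen_iff_forall_mem_open]
        intro K hK
        have hKU : (K.1.1 : Set X) ⊆ U := hK
        have hKc : IsCompact (K.1.1 : Set X) := K.2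
        obtain ⟨f, hf⟩ := hKc.elim_finite_subcover
          (fun b : {b : B // (b : Set X) ⊆ U} => (b.1 : Set X))
          (fun b => hB.isOpen b.1.2) (by
            intro x hx
            obtain ⟨b, hb, hxb, hbU⟩ := hB.exists_subset_of_mem_open (hKU hx) hU
            exact mem_iUnion.2 ⟨⟨⟨b, hb⟩, hbU⟩, hxb⟩)
        classical
        refine ⟨P (⋃ b ∈ f.image Subtype.val, (b : Set X)), ?_,
          isOpen_generateFrom_of_mem (Or.inl ⟨_, rfl⟩), ?_⟩
        · intro L hL
          have hL' : (L.1.1 : Set X) ⊆ _ := hL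
          refine hL'.trans ?_
          intro x hx
          simp only [mem_iUnion] at hx
          obtain ⟨b, hb, hx⟩ := hx
          obtain ⟨c, _, rfl⟩ := Finset.mem_image.1 hb
          exact c.2 hx
        · intro x hx
          obtain ⟨c, hc, hx⟩ := mem_iUnion₂.1 (hf hx)
          exact mem_iUnion₂.2 ⟨c.1, Finset.mem_image_of_mem _ hc, hx⟩
      · rw [isOpen_iff_forall_mem_open]
        rintro K ⟨x, hxK, hxU⟩
        obtain ⟨b, hb, hxb, hbU⟩ := hB.exists_subset_of_mem_open hxU hU
        refine ⟨M b, ?_, isOpen_generateFrom_of_mem (Or.inr ⟨⟨b, hb⟩, rfl⟩), ⟨x, hxK, hxb⟩⟩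
        rintro L ⟨y, hy, hyb⟩
        exact ⟨y, hy, hbU hyb⟩
  · letI τ : TopologicalSpace (CompSet X) :=
      TopologicalSpace.induced Subtype.val (vietoris X)
    obtain ⟨B, hB, hBc⟩ := weight_attained (CompSet X) τ
    let e : X → CompSet X := fun x =>
      ⟨⟨{x}, isClosed_singleton, singleton_nonempty x⟩, isCompact_singleton⟩
    have he : IsInducing e := by
      constructor
      change T = induced e (induced Subtype.val (vietoris X))
      rw [induced_compose, vietoris, induced_generateFrom_eq]
      apply le_antisymm
      · apply le_generateFrom
        rintro _ ⟨_, (⟨U, hU, rfl⟩ | ⟨U, hU, rfl⟩), rfl⟩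
        · convert (show IsOpen U from hU) using 1
          ext x
          simp [hyperPlus, e]
        · convert (show IsOpen U from hU) using 1
          ext x
          simp [hyperMinus, e]
      · intro U hU
        apply isOpen_generateFrom_of_mem
        refine ⟨_, Or.inl ⟨U, hU, rfl⟩, ?_⟩
        ext x
        simp [hyperPlus, e]
    rw [← hBc]
    exact (weight_le_of_basis (hB.isInducing he)).trans Cardinal.mk_image_le
end
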